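/- arXiv:math/0202309 — 2 statements merged into one kernel-verified Lean document; each statement's English description precedes it below -/
import Mathlib

section
/- Banach–Tarski paradox (doubling form): the closed unit ball in three-dimensional Euclidean space is equidecomposable with the union of two disjoint copies of itself; that is, there exist a positive integer n, a partition of the closed unit ball B into pairwise disjoint pieces A₁, …, Aₙ, and isometries g₁, …, gₙ of ℝ³ such that the images g₁(A₁), …, gₙ(Aₙ) are pairwise disjoint and their union is B ∪ B', where B' is a translate of B disjoint from B. -/
/-- Two subsets `X, Y` of `ℝ³` are *equidecomposable* if there are a positive number `n`
of pairwise disjoint pieces `A 1, …, A n` partitioning `X` and isometries `g 1, …, g n`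
of `ℝ³` such that the images `g i '' A i` are pairwise disjoint with union `Y`. -/
def Equidecomposable (X Y : Set (EuclideanSpace ℝ (Fin 3))) : Prop :=
  ∃ n : ℕ, 0 < n ∧
    ∃ (A : Fin n → Set (EuclideanSpace ℝ (Fin 3)))
      (g : Fin n → (EuclideanSpace ℝ (Fin 3) ≃ᵢ EuclideanSpace ℝ (Fin 3))),
      (∀ i j, i ≠ j → Disjoint (A i) (A j)) ∧
      X = ⋃ i, A i ∧
      (∀ i j, i ≠ j → Disjoint (g i '' A i) (g j '' A j)) ∧
      Y = ⋃ i, g i '' A i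

namespace BanachTarski

open FreeGroup (IsReduced isReduced_cons_cons isReduced_toWord lift_mk mk_toWord)

/-- Five times the rotations by `± arccos (3 / 5)` about the third (for `(false, _)`) and the first
(for `(true, _)`) coordinate axes. -/
def fiveRot : Bool × Bool → Matrix (Fin 3) (Fin 3) ℤ
  | (false, true) => !![3, -4, 0; 4, 3, 0; 0, 0, 5]
  | (false, false) => !![3, 4, 0; -4, 3, 0; 0, 0, 5]
  | (true, true) => !![5, 0, 0; 0, 3, -4; 0, 4, 3]
  | (true, false) => !![5, 0, 0; 0, 3, 4; 0, -4, 3]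

/-- A spanning vector of the image of `fiveRot l` modulo five. -/
def imageVec : Bool × Bool → Fin 3 → ZMod 5
  | (false, true) => ![1, 3, 0]
  | (false, false) => ![1, 2, 0]
  | (true, true) => ![0, 1, 3]
  | (true, false) => ![0, 1, 2]

/-- The reduction of `fiveRot l` modulo five. -/
def fiveRotMod (l : Bool × Bool) : Matrix (Fin 3) (Fin 3) (ZMod 5) :=
  (Int.castRingHom (ZMod 5)).mapMatrix (fiveRot l)

theorem fiveRotMod_mulVec_imageVec :
    ∀ l m : Bool × Bool, (l.1 = m.1 → l.2 = m.2) →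
      ∃ c : ZMod 5, c ≠ 0 ∧ (fiveRotMod l).mulVec (imageVec m) = c • imageVec l := by
  decide

theorem fiveRotMod_mulVec_one :
    ∀ l : Bool × Bool, ∃ c : ZMod 5, c ≠ 0 ∧ (fiveRotMod l).mulVec 1 = c • imageVec l := by
  decide

theorem imageVec_ne_zero : ∀ l : Bool × Bool, imageVec l ≠ 0 := by
  decide

theorem prod_fiveRotMod_mulVec (L : List (Bool × Bool)) :
    ∀ l : Bool × Bool, IsReduced (l :: L) → ∃ c : ZMod 5, c ≠ 0 ∧
      (((l :: L).map fiveRotMod).prod).mulVec 1 = c • imageVec l := by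
  have : Fact (Nat.Prime 5) := ⟨by norm_num⟩
  induction L with
  | nil =>
    intro l _
    simpa using fiveRotMod_mulVec_one l
  | cons m L ih =>
    intro l h
    rw [isReduced_cons_cons] at h
    obtain ⟨c, hc, hcm⟩ := ih m h.2
    obtain ⟨d, hd, hdl⟩ := fiveRotMod_mulVec_imageVec l m h.1
    refine ⟨c * d, mul_ne_zero hc hd, ?_⟩
    rw [List.map_cons, List.prod_cons, ← Matrix.mulVec_mulVec, hcm, Matrix.mulVec_smul, hdl,
      smul_smul]

theorem prod_fiveRotMod_ne_zero {L : List (Bool × Bool)} (hL : IsReduced L) :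
    (L.map fiveRotMod).prod ≠ 0 := by
  have : Fact (Nat.Prime 5) := ⟨by norm_num⟩
  cases L with
  | nil => simp
  | cons l L =>
    intro h
    obtain ⟨c, hc, hcl⟩ := prod_fiveRotMod_mulVec L l hL
    rw [h, Matrix.zero_mulVec] at hcl
    exact smul_ne_zero hc (imageVec_ne_zero l) hcl.symm

/-- The rotation `fiveRot l / 5`. -/
noncomputable def rotMatrix (l : Bool × Bool) : Matrix (Fin 3) (Fin 3) ℝ :=
  (5⁻¹ : ℝ) • (Int.castRingHom ℝ).mapMatrix (fiveRot l)

theorem star_rotMatrix (s b : Bool) : star (rotMatrix (s, b)) = rotMatrix (s, !b) := by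
  ext i j
  cases s <;> cases b <;> fin_cases i <;> fin_cases j <;>
    simp [rotMatrix, fiveRot]

theorem rotMatrix_mul_rotMatrix_not (s b : Bool) :
    rotMatrix (s, b) * rotMatrix (s, !b) = 1 := by
  have h : ∀ s b, fiveRot (s, b) * fiveRot (s, !b) = (25 : ℤ) • 1 := by decide
  rw [rotMatrix, rotMatrix, Matrix.smul_mul, Matrix.mul_smul, ← map_mul, h, map_zsmul, map_one,
    ← Int.cast_smul_eq_zsmul ℝ, smul_smul, smul_smul]
  norm_num

/-- The two generating rotations. -/
noncomputable def rotGen (s : Bool) : unitary (Matrix (Fin 3) (Fin 3) ℝ) :=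
  ⟨rotMatrix (s, true), by
    have h := rotMatrix_mul_rotMatrix_not s
    rw [Unitary.mem_iff, star_rotMatrix]
    exact ⟨h false, h true⟩⟩

theorem coe_lift_rotGen_mk (L : List (Bool × Bool)) :
    (5 ^ L.length : ℝ) • (FreeGroup.lift rotGen (FreeGroup.mk L) : Matrix (Fin 3) (Fin 3) ℝ) =
      (Int.castRingHom ℝ).mapMatrix (L.map fiveRot).prod := by
  induction L with
  | nil => simp
  | cons l L ih =>
    have hl : ((cond l.2 (rotGen l.1) (rotGen l.1)⁻¹ : unitary _) : Matrix (Fin 3) (Fin 3) ℝ) =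
        rotMatrix l := by
      obtain ⟨s, b⟩ := l
      cases b
      · exact star_rotMatrix s true
      · rfl
    rw [lift_mk] at ih ⊢
    rw [List.map_cons, List.map_cons, List.prod_cons, List.prod_cons, map_mul, ← ih,
      Submonoid.coe_mul, hl, rotMatrix, List.length_cons, pow_succ', Matrix.smul_mul,
      Matrix.mul_smul, smul_smul]
    congr 1
    field_simp

theorem lift_rotGen_injective : Function.Injective (FreeGroup.lift rotGen) := by
  rw [injective_iff_map_eq_one]
  intro w hw
  by_contra hne
  have h := coe_lift_rotGen_mk w.toWord
  rw [mk_toWord, hw, OneMemClass.coe_one] at h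
  have hZ : (w.toWord.map fiveRot).prod = (5 ^ w.toWord.length : ℤ) • 1 := by
    apply Matrix.map_injective (RingHom.injective_int (Int.castRingHom ℝ))
    change (Int.castRingHom ℝ).mapMatrix _ = (Int.castRingHom ℝ).mapMatrix _
    rw [← h, map_zsmul, map_one, ← Int.cast_smul_eq_zsmul ℝ]
    push_cast
    rfl
  apply prod_fiveRotMod_ne_zero (isReduced_toWord (x := w))
  have hlen : w.toWord.length ≠ 0 := by simpa using hne
  have hmod := congrArg (Int.castRingHom (ZMod 5)).mapMatrix hZ
  rw [map_list_prod, List.map_map, map_zsmul, map_one, ← Int.cast_smul_eq_zsmul (ZMod 5)] at hmod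
  refine hmod.trans ?_
  push_cast
  rw [show (5 : ZMod 5) = 0 from rfl, zero_pow hlen, zero_smul]

/-- The star monoid homomorphism sending a matrix to the operator it defines on `ℝ³`. -/
noncomputable def matrixToCLM : Matrix (Fin 3) (Fin 3) ℝ →⋆*
    (EuclideanSpace ℝ (Fin 3) →L[ℝ] EuclideanSpace ℝ (Fin 3)) where
  toFun := Matrix.toEuclideanCLM (n := Fin 3) (𝕜 := ℝ)
  map_one' := map_one _
  map_mul' := map_mul _
  map_star' := map_star _

/-- The action of the free group on two generators on `ℝ³` by rotations about the origin. -/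
noncomputable def rotHom :
    FreeGroup Bool →* (EuclideanSpace ℝ (Fin 3) ≃ₗᵢ[ℝ] EuclideanSpace ℝ (Fin 3)) :=
  (Unitary.linearIsometryEquiv.toMonoidHom.comp (Unitary.map matrixToCLM).toMonoidHom).comp
    (FreeGroup.lift rotGen)

theorem rotHom_injective : Function.Injective rotHom :=
  (Unitary.linearIsometryEquiv.injective.comp
    (Unitary.map_injective (Matrix.toEuclideanCLM (n := Fin 3) (𝕜 := ℝ)).injective)).comp
    lift_rotGen_injective


open FreeGroup (startsWith startsWith_mk_mul)

/-- The points of trivial stabilizer for an action of a group. -/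
def freePoints (G X : Type*) [Group G] [MulAction G X] : Set X :=
  {x | ∀ g : G, g • x = x → g = 1}

theorem smul_mem_freePoints {G X : Type*} [Group G] [MulAction G X] {x : X}
    (hx : x ∈ freePoints G X) (g : G) : g • x ∈ freePoints G X := by
  intro h hh
  have h1 : (g⁻¹ * h * g) • x = x := by rw [mul_smul, mul_smul, hh, inv_smul_smul]
  have h2 := hx _ h1
  rwa [mul_assoc, inv_mul_eq_one, eq_comm, mul_eq_right] at h2

/-- The factor by which `g` is multiplied to be moved into the set of words starting with `s` or
`s⁻¹`. -/
noncomputable def paradoxFactor (s : Bool) (g : FreeGroup Bool) : FreeGroup Bool := by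
  classical exact if g ∈ startsWith (s, true) then 1 else FreeGroup.mk [(s, false)]

theorem eq_of_paradoxFactor_mul_eq {s t : Bool} {g h : FreeGroup Bool}
    (H : paradoxFactor s g * g = paradoxFactor t h * h) : s = t ∧ g = h := by
  have key : ∀ s g, ∃ b, paradoxFactor s g * g ∈ startsWith (s, b) ∧
      (b = true ↔ g ∈ startsWith (s, true)) := by
    intro s g
    by_cases hg : g ∈ startsWith (s, true)
    · exact ⟨true, by simp [paradoxFactor, hg], by simp [hg]⟩
    · exact ⟨false, by simpa [paradoxFactor, hg] using startsWith_mk_mul (w := (s, false)) g hg,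
        by simp [hg]⟩
  obtain ⟨b, hb, hb'⟩ := key s g
  obtain ⟨c, hc, hc'⟩ := key t h
  rw [H] at hb
  have hbc : (s, b) = (t, c) := by
    by_contra hne
    exact (FreeGroup.startsWith.disjoint_iff_ne.2 hne).notMem_of_mem_left hb hc
  obtain ⟨rfl, rfl⟩ := Prod.mk.inj hbc
  refine ⟨rfl, ?_⟩
  have hgh : g ∈ startsWith (s, true) ↔ h ∈ startsWith (s, true) := hb'.symm.trans hc'
  have : paradoxFactor s g = paradoxFactor s h := by
    unfold paradoxFactor
    split_ifs <;> tauto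
  rw [this] at H
  exact mul_left_cancel H

/-- Multiplying by `1` or by the inverse of a generator, two copies of the set of points of trivial
stabilizer inject into one. -/
theorem exists_paradoxical_map {X : Type*} [MulAction (FreeGroup Bool) X] :
    ∃ c : Bool → X → FreeGroup Bool,
      (∀ s x, c s x = 1 ∨ c s x = FreeGroup.mk [(s, false)]) ∧
      ∀ s t, ∀ x ∈ freePoints (FreeGroup Bool) X, ∀ y ∈ freePoints (FreeGroup Bool) X,
        c s x • x = c t y • y → s = t ∧ x = y := by
  classical
  let _ : Setoid X := MulAction.orbitRel (FreeGroup Bool) X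
  let r : X → X := fun x ↦ (Quotient.mk' x).out
  have hr : ∀ x, ∃ g : FreeGroup Bool, g • r x = x := fun x ↦
    MulAction.orbitRel_apply.1 (Setoid.symm (Quotient.mk_out x))
  have hrs : ∀ (g : FreeGroup Bool) x, r (g • x) = r x := by
    intro g x
    have : Quotient.mk' (g • x) = Quotient.mk' x :=
      Quotient.sound (MulAction.orbitRel_apply.2 ⟨g, rfl⟩)
    simp only [r, this]
  choose k hk using hr
  have hks : ∀ x ∈ freePoints (FreeGroup Bool) X, ∀ g, k (g • x) = g * k x := by
    intro x hx g
    have h1 : (k x)⁻¹ • x = r x := by rw [inv_smul_eq_iff, hk]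
    have h2 := smul_mem_freePoints hx (k x)⁻¹
    rw [h1] at h2
    have h3 : ((g * k x)⁻¹ * k (g • x)) • r x = r x := by
      rw [mul_smul, inv_smul_eq_iff, mul_smul, hk, ← hrs g x, hk]
    exact (inv_mul_eq_one.1 (h2 _ h3)).symm
  refine ⟨fun s x ↦ paradoxFactor s (k x), fun s x ↦ ?_, fun s t x hx y hy h ↦ ?_⟩
  · by_cases hg : k x ∈ startsWith (s, true) <;> simp [paradoxFactor, hg]
  · have h1 := congrArg k h
    have h2 := congrArg r h
    rw [hks x hx, hks y hy] at h1
    rw [hrs, hrs] at h2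
    obtain ⟨hst, hkxy⟩ := eq_of_paradoxFactor_mul_eq h1
    exact ⟨hst, by rw [← hk x, ← hk y, hkxy, h2]⟩

open Pointwise in
/-- Suitable finite subsets of the free group expand all finite sets of points of trivial stabilizer
by an arbitrarily large factor. -/
theorem exists_two_pow_mul_card_le (X : Type*) [DecidableEq X] [MulAction (FreeGroup Bool) X]
    (n : ℕ) :
    ∃ T : Finset (FreeGroup Bool), ∀ A : Finset X, ↑A ⊆ freePoints (FreeGroup Bool) X →
      2 ^ n * A.card ≤ (T • A).card := by
  obtain ⟨c, hc, hinj⟩ := exists_paradoxical_map (X := X)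
  let T₀ : Finset (FreeGroup Bool) := insert 1 (Finset.univ.image fun s ↦ FreeGroup.mk [(s, false)])
  have hT₀ : ∀ A : Finset X, ↑A ⊆ freePoints (FreeGroup Bool) X →
      2 * A.card ≤ (T₀ • A).card := by
    intro A hA
    have : 2 * A.card = ((Finset.univ : Finset Bool) ×ˢ A).card := by simp
    rw [this]
    refine Finset.card_le_card_of_injOn (fun p ↦ c p.1 p.2 • p.2) ?_ ?_
    · rintro ⟨s, x⟩ hp
      refine Finset.smul_mem_smul ?_ (by simpa using hp)
      rcases hc s x with h | h <;> cases s <;> simp [T₀, h]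
    · rintro ⟨s, x⟩ hp ⟨t, y⟩ hq h
      simp only [Finset.coe_product, Set.mem_prod, Finset.mem_coe] at hp hq
      obtain ⟨h1, h2⟩ := hinj s t x (hA hp.2) y (hA hq.2) h
      rw [h1, h2]
  induction n with
  | zero => exact ⟨{1}, fun A _ ↦ by simp⟩
  | succ n ih =>
    obtain ⟨T, hT⟩ := ih
    refine ⟨T₀ * T, fun A hA ↦ ?_⟩
    have hTA : ↑(T • A) ⊆ freePoints (FreeGroup Bool) X := by
      intro x hx
      obtain ⟨g, -, a, ha, rfl⟩ := Finset.mem_smul.1 (Finset.mem_coe.1 hx)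
      exact smul_mem_freePoints (hA ha) g
    have h1 := hT A hA
    have h2 := hT₀ _ hTA
    rw [mul_smul, pow_succ]
    lia


open MeasureTheory Module

/-- Euclidean three-space. -/
abbrev E3 := EuclideanSpace ℝ (Fin 3)

/-- The action of the free group on two generators by rotations. -/
noncomputable instance rotAction : MulAction (FreeGroup Bool) E3 where
  smul w x := rotHom w x
  one_smul x := by
    change rotHom 1 x = x
    rw [map_one]; rfl
  mul_smul v w x := by
    change rotHom (v * w) x = rotHom v (rotHom w x)
    rw [map_mul]; rfl

theorem rot_smul_def (w : FreeGroup Bool) (x : E3) : w • x = rotHom w x := rfl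

section FixedSpace

variable {F : Type*} [NormedAddCommGroup F] [InnerProductSpace ℝ F]

/-- The subspace of vectors fixed by a linear isometry. -/
noncomputable def fixedSpace (φ : F ≃ₗᵢ[ℝ] F) : Submodule ℝ F :=
  (ContinuousLinearMap.id ℝ F - φ).ker

theorem mem_fixedSpace {φ : F ≃ₗᵢ[ℝ] F} {x : F} : x ∈ fixedSpace φ ↔ φ x = x :=
  (by simp [fixedSpace, sub_eq_zero] : x ∈ fixedSpace φ ↔ x = φ x).trans eq_comm

theorem finrank_fixedSpace_add_two_le [FiniteDimensional ℝ F] {φ : F ≃ₗᵢ[ℝ] F} (hφ : φ ^ 2 ≠ 1) :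
    finrank ℝ (fixedSpace φ) + 2 ≤ finrank ℝ F := by
  by_contra! h
  apply hφ
  have h3 := (fixedSpace φ).finrank_add_finrank_orthogonal
  obtain ⟨l, hl, hφl⟩ := φ.reflections_generate_dim_aux (n := 1)
    (show finrank ℝ (fixedSpace φ)ᗮ ≤ 1 by lia)
  match l, hl with
  | [], _ => simp [hφl]
  | [v], _ =>
    rw [hφl, List.map_singleton, List.prod_singleton, pow_two]
    exact Submodule.reflection_mul_reflection _

end FixedSpace

theorem finrank_fixedSpace_rotHom_le_one {w : FreeGroup Bool} (hw : w ≠ 1) :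
    finrank ℝ (fixedSpace (rotHom w)) ≤ 1 := by
  have h := finrank_fixedSpace_add_two_le (φ := rotHom w) <| by
    rw [← map_pow, map_ne_one_iff _ rotHom_injective]
    exact fun h ↦ hw ((pow_eq_one_iff_left two_ne_zero).1 h)
  rw [finrank_euclideanSpace_fin] at h
  exact Nat.le_of_add_le_add_right h

theorem exists_translation_mem_freePoints :
    ∃ v : E3, ∀ x : E3, x ∈ freePoints (FreeGroup Bool) E3 ∨
      x - v ∈ freePoints (FreeGroup Bool) E3 := by
  let I := {w : FreeGroup Bool // w ≠ 1}
  let K : I × I → Submodule ℝ E3 := fun p ↦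
    fixedSpace (rotHom p.1) ⊔ fixedSpace (rotHom p.2)
  have hK : ∀ p, K p ≠ ⊤ := by
    intro p hp
    have h1 := Submodule.finrank_add_le_finrank_add_finrank
      (fixedSpace (rotHom p.1)) (fixedSpace (rotHom p.2))
    have h2 := finrank_fixedSpace_rotHom_le_one p.1.2
    have h3 := finrank_fixedSpace_rotHom_le_one p.2.2
    have h4 : finrank ℝ (K p) = 3 := by rw [hp, finrank_top, finrank_euclideanSpace_fin]
    change finrank ℝ (K p) ≤ _ at h1
    lia
  have : Countable (FreeGroup Bool) := FreeGroup.toWord_injective.countable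
  have h0 : volume (⋃ p, (K p : Set E3)) = 0 :=
    measure_iUnion_null fun p ↦ Measure.addHaar_submodule volume (K p) (hK p)
  obtain ⟨v, hv⟩ : ∃ v, v ∉ ⋃ p, (K p : Set E3) := by
    by_contra! h
    rw [Set.eq_univ_of_forall h] at h0
    exact isOpen_univ.measure_ne_zero volume Set.univ_nonempty h0
  refine ⟨v, fun x ↦ ?_⟩
  by_contra! h
  simp only [freePoints, Set.mem_ofPred_eq, not_forall] at h
  obtain ⟨⟨w, hwx, hw⟩, ⟨w', hwx', hw'⟩⟩ := h
  refine hv (Set.mem_iUnion.2 ⟨(⟨w, hw⟩, ⟨w', hw'⟩), ?_⟩)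
  have := Submodule.sub_mem (K (⟨w, hw⟩, ⟨w', hw'⟩))
    (Submodule.mem_sup_left (mem_fixedSpace.2 hwx)) (Submodule.mem_sup_right (mem_fixedSpace.2 hwx'))
  simpa using this


open Metric

open Pointwise in
/-- There are finite families of isometries of arbitrarily large expansion which all move the unit
ball into the same ball. -/
theorem exists_isometries_two_pow_mul_card_le :
    ∃ R : ℝ, 0 ≤ R ∧ ∀ n : ℕ, ∃ S : Finset (E3 ≃ᵢ E3),
      (∀ s ∈ S, ∀ x ∈ closedBall (0 : E3) 1, s x ∈ closedBall (0 : E3) R) ∧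
      ∀ A : Finset E3, 2 ^ n * A.card ≤ 2 * (Finset.image₂ (fun s x ↦ s x) S A).card := by
  classical
  obtain ⟨v, hv⟩ := exists_translation_mem_freePoints
  refine ⟨1 + 2 * ‖v‖, by positivity, fun n ↦ ?_⟩
  obtain ⟨T, hT⟩ := exists_two_pow_mul_card_le E3 n
  let rot : FreeGroup Bool → (E3 ≃ᵢ E3) := fun w ↦ (rotHom w).toIsometryEquiv
  let rot' : FreeGroup Bool → (E3 ≃ᵢ E3) := fun w ↦
    ((IsometryEquiv.addRight (-v)).trans (rot w)).trans (IsometryEquiv.addRight v)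
  have hrot : ∀ w x, rot w x = w • x := fun w x ↦ rfl
  have hrot' : ∀ w x, rot' w x = w • (x - v) + v := fun w x ↦ by
    simp [rot', hrot, sub_eq_add_neg]
  have hnorm : ∀ (w : FreeGroup Bool) (x : E3), ‖w • x‖ = ‖x‖ := fun w x ↦ (rotHom w).norm_map x
  refine ⟨T.image rot ∪ T.image rot', ?_, fun A ↦ ?_⟩
  · intro s hs x hx
    rw [mem_closedBall_zero_iff] at hx ⊢
    rcases Finset.mem_union.1 hs with hs | hs <;> obtain ⟨w, -, rfl⟩ := Finset.mem_image.1 hs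
    · rw [hrot, hnorm]
      linarith [norm_nonneg v]
    · rw [hrot']
      have h1 := norm_add_le (w • (x - v)) v
      have h2 := norm_sub_le x v
      rw [hnorm] at h1
      linarith
  · set Q := Finset.image₂ (fun (s : E3 ≃ᵢ E3) x ↦ s x) (T.image rot ∪ T.image rot') A
    have hcard := A.card_filter_add_card_filter_not (· ∈ freePoints (FreeGroup Bool) E3)
    set A₁ := A.filter (· ∈ freePoints (FreeGroup Bool) E3)
    set A₂ := A.filter (¬ · ∈ freePoints (FreeGroup Bool) E3)
    have h1 : 2 ^ n * A₁.card ≤ Q.card := by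
      refine (hT A₁ fun x hx ↦ (Finset.mem_filter.1 hx).2).trans (Finset.card_le_card ?_)
      intro y hy
      obtain ⟨w, hw, x, hx, rfl⟩ := Finset.mem_smul.1 hy
      exact Finset.mem_image₂.2 ⟨rot w, Finset.mem_union_left _ (Finset.mem_image_of_mem _ hw), x,
        (Finset.mem_filter.1 hx).1, rfl⟩
    have h2 : 2 ^ n * A₂.card ≤ Q.card := by
      rw [← Finset.card_image_of_injective A₂ (sub_left_injective (b := v))]
      refine (hT _ ?_).trans ?_
      · intro x hx
        obtain ⟨y, hy, rfl⟩ := Finset.mem_image.1 (Finset.mem_coe.1 hx)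
        exact (hv y).resolve_left (Finset.mem_filter.1 hy).2
      · refine Finset.card_le_card_of_injOn (· + v) ?_ (add_left_injective v).injOn
        intro y hy
        obtain ⟨w, hw, z, hz, rfl⟩ := Finset.mem_smul.1 (Finset.mem_coe.1 hy)
        obtain ⟨x, hx, rfl⟩ := Finset.mem_image.1 hz
        exact Finset.mem_image₂.2 ⟨rot' w, Finset.mem_union_right _ (Finset.mem_image_of_mem _ hw),
          x, (Finset.mem_filter.1 hx).1, hrot' w x⟩
    rw [← hcard]
    lia

theorem exists_isometries_two_mul_card_le [DecidablePred (· ∈ closedBall (0 : E3) 1)] :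
    ∃ S : Finset (E3 ≃ᵢ E3), ∀ A : Finset E3, ↑A ⊆ closedBall (0 : E3) 1 →
      2 * A.card ≤
        ((Finset.image₂ (fun s x ↦ s x) S A).filter (· ∈ closedBall (0 : E3) 1)).card := by
  classical
  obtain ⟨R, hR, hS⟩ := exists_isometries_two_pow_mul_card_le
  obtain ⟨t, -, htf, ht⟩ := (isCompact_closedBall (0 : E3) R).finite_cover_balls one_pos
  lift t to Finset E3 using htf
  obtain ⟨n, hn⟩ := pow_unbounded_of_one_lt (4 * t.card) one_lt_two
  obtain ⟨S, hSR, hSA⟩ := hS n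
  let S' : Finset (E3 ≃ᵢ E3) :=
    Finset.image₂ (fun u s ↦ s.trans (IsometryEquiv.addRight (-u))) t S
  refine ⟨S', fun A hA ↦ ?_⟩
  set Q := Finset.image₂ (fun (s : E3 ≃ᵢ E3) x ↦ s x) S A
  set P := (Finset.image₂ (fun (s : E3 ≃ᵢ E3) x ↦ s x) S' A).filter (· ∈ closedBall (0 : E3) 1)
  have hQP : Q ⊆ Finset.image₂ (fun u x ↦ x + u) t P := by
    intro y hy
    obtain ⟨s, hs, x, hx, rfl⟩ := Finset.mem_image₂.1 hy
    obtain ⟨u, hu, hsu⟩ := Set.mem_iUnion₂.1 (ht (hSR s hs x (hA hx)))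
    refine Finset.mem_image₂.2 ⟨u, hu, s x - u, Finset.mem_filter.2 ⟨?_, ?_⟩, sub_add_cancel _ _⟩
    · exact Finset.mem_image₂.2 ⟨_, Finset.mem_image₂_of_mem hu hs, x, hx,
        (sub_eq_add_neg _ _).symm⟩
    · rw [mem_closedBall_zero_iff, ← dist_eq_norm]
      exact (mem_ball.1 hsu).le
  have h1 := (Finset.card_le_card hQP).trans (Finset.card_image₂_le _ t P)
  have h2 := hSA A
  have ht0 : 0 < t.card := by
    obtain ⟨u, hu, -⟩ := Set.mem_iUnion₂.1 (ht (mem_closedBall_self hR))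
    exact Finset.card_pos.2 ⟨u, hu⟩
  have h3 : 2 * t.card * (2 * A.card) ≤ 2 * t.card * P.card := by
    have := Nat.mul_le_mul_right A.card hn.le
    linarith
  exact Nat.le_of_mul_le_mul_left h3 (by positivity)

/-- Two copies of the unit ball inject piecewise into the unit ball, by Hall's theorem. -/
theorem exists_injective_bool_prod_closedBall :
    ∃ S : Finset (E3 ≃ᵢ E3), ∃ f : Bool × closedBall (0 : E3) 1 → E3,
      Function.Injective f ∧ ∀ p, f p ∈ closedBall (0 : E3) 1 ∧ ∃ s ∈ S, s p.2 = f p := by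
  classical
  obtain ⟨S, hS⟩ := exists_isometries_two_mul_card_le
  let t : Bool × closedBall (0 : E3) 1 → Finset E3 := fun p ↦
    (S.image fun s ↦ s p.2).filter (· ∈ closedBall (0 : E3) 1)
  obtain ⟨f, hf, hft⟩ := (Finset.all_card_le_biUnion_card_iff_exists_injective t).1 <| by
    intro I
    let A : Finset E3 := I.image fun p ↦ (p.2 : E3)
    have hA : ↑A ⊆ closedBall (0 : E3) 1 := by
      intro x hx
      obtain ⟨p, -, rfl⟩ := Finset.mem_image.1 (Finset.mem_coe.1 hx)
      exact p.2.2
    have h1 : I.card ≤ ((Finset.univ : Finset Bool) ×ˢ A).card := by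
      refine Finset.card_le_card_of_injOn (fun p ↦ (p.1, (p.2 : E3))) ?_ ?_
      · intro p hp
        exact Finset.mem_product.2 ⟨Finset.mem_univ _, Finset.mem_image_of_mem _ hp⟩
      · rintro ⟨i, x⟩ - ⟨j, y⟩ - h
        simpa [Subtype.ext_iff] using h
    rw [Finset.card_product, Finset.card_univ, Fintype.card_bool] at h1
    refine (h1.trans (hS A hA)).trans (Finset.card_le_card ?_)
    intro y hy
    obtain ⟨hy, hyB⟩ := Finset.mem_filter.1 hy
    obtain ⟨s, hs, x, hx, rfl⟩ := Finset.mem_image₂.1 hy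
    obtain ⟨p, hp, rfl⟩ := Finset.mem_image.1 hx
    exact Finset.mem_biUnion.2 ⟨p, hp, Finset.mem_filter.2 ⟨Finset.mem_image_of_mem _ hs, hyB⟩⟩
  refine ⟨S, f, hf, fun p ↦ ?_⟩
  obtain ⟨h1, h2⟩ := Finset.mem_filter.1 (hft p)
  exact ⟨h2, Finset.mem_image.1 h1⟩

theorem equidecomposable_of_bijective {X Y : Set E3} (S : Finset (E3 ≃ᵢ E3)) {h : X → Y}
    (hh : Function.Bijective h) (hS : ∀ x : X, ∃ s ∈ S, s x = h x) (hX : X.Nonempty) :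
    Equidecomposable X Y := by
  choose k hkS hk using hS
  have hk' : ∀ x, ∃ i : Fin S.card, (S.equivFin.symm i : E3 ≃ᵢ E3) = k x := fun x ↦
    ⟨S.equivFin ⟨k x, hkS x⟩, by simp⟩
  choose i hi using hk'
  have himage : ∀ j, (fun x ↦ (S.equivFin.symm j : E3 ≃ᵢ E3) x) '' (Subtype.val '' (i ⁻¹' {j})) =
      (fun x ↦ (h x : E3)) '' (i ⁻¹' {j}) := by
    intro j
    rw [Set.image_image]
    refine Set.image_congr fun x hx ↦ ?_
    rw [← hk x, ← hi x, show i x = j from hx]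
  have hdisj : ∀ j j', j ≠ j' → Disjoint (i ⁻¹' {j}) (i ⁻¹' {j'}) := fun j j' hj ↦
    Disjoint.preimage _ (Set.disjoint_singleton.2 hj)
  have huniv : ⋃ j, i ⁻¹' {j} = Set.univ := by
    rw [← Set.preimage_iUnion, Set.iUnion_of_singleton, Set.preimage_univ]
  obtain ⟨x, hx⟩ := hX
  refine ⟨S.card, Finset.card_pos.2 ⟨_, hkS ⟨x, hx⟩⟩, fun j ↦ Subtype.val '' (i ⁻¹' {j}),
    fun j ↦ S.equivFin.symm j, fun j j' hj ↦ ?_, ?_, fun j j' hj ↦ ?_, ?_⟩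
  · exact (Set.disjoint_image_iff Subtype.val_injective).2 (hdisj j j' hj)
  · rw [← Set.image_iUnion, huniv, Set.image_univ, Subtype.range_coe]
  · rw [himage, himage]
    exact (Set.disjoint_image_iff (Subtype.val_injective.comp hh.1)).2 (hdisj j j' hj)
  · simp_rw [himage]
    rw [← Set.image_iUnion, huniv, Set.image_univ]
    exact (Subtype.range_coe.symm.trans (hh.2.range_comp _).symm)

/-- If two copies of `B` inject piecewise into `B`, then `B` is equidecomposable with its union
with any set covered by a translate of `B`. -/
theorem equidecomposable_union {B B' : Set E3} (S : Finset (E3 ≃ᵢ E3)) {f : Bool × B → E3}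
    (hf : Function.Injective f) (hfS : ∀ p, f p ∈ B ∧ ∃ s ∈ S, s p.2 = f p) {v : E3}
    (hB' : ∀ x ∈ B', x - v ∈ B) (hB : B.Nonempty) : Equidecomposable B (B ∪ B') := by
  classical
  let F : (B ∪ B' : Set E3) → B := fun y ↦
    if hy : (y : E3) ∈ B then ⟨f (false, ⟨y, hy⟩), (hfS _).1⟩
    else ⟨f (true, ⟨y - v, hB' _ (y.2.resolve_left hy)⟩), (hfS _).1⟩
  have hF : Function.Injective F := by
    intro y z h
    by_cases hy : (y : E3) ∈ B <;> by_cases hz : (z : E3) ∈ B <;>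
      simp [F, hy, hz, hf.eq_iff, Subtype.ext_iff] at h <;> exact Subtype.ext h
  let S' : Finset (E3 ≃ᵢ E3) := insert (IsometryEquiv.refl _)
    (S.image (fun s ↦ s.symm) ∪ S.image fun s ↦ s.symm.trans (IsometryEquiv.addRight v))
  obtain ⟨h, hh, hhS⟩ := Function.Embedding.schroeder_bernstein_of_rel
    (Set.inclusion_injective (Set.subset_union_left (s := B) (t := B'))) hF
    (fun x y ↦ ∃ s ∈ S', s (x : E3) = y)
    (fun x ↦ ⟨IsometryEquiv.refl _, Finset.mem_insert_self _ _, rfl⟩) <| by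
      intro y
      by_cases hy : (y : E3) ∈ B
      · obtain ⟨-, s, hs, hsy⟩ := hfS (false, ⟨y, hy⟩)
        refine ⟨s.symm, Finset.mem_insert_of_mem
          (Finset.mem_union_left _ (Finset.mem_image_of_mem _ hs)), ?_⟩
        simp [F, hy, ← hsy]
      · obtain ⟨-, s, hs, hsy⟩ := hfS (true, ⟨y - v, hB' _ (y.2.resolve_left hy)⟩)
        refine ⟨s.symm.trans (IsometryEquiv.addRight v), Finset.mem_insert_of_mem
          (Finset.mem_union_right _ (Finset.mem_image_of_mem _ hs)), ?_⟩
        simp [F, hy, ← hsy]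
  exact equidecomposable_of_bijective S' hh hhS hB

end BanachTarski

/-- **Banach–Tarski paradox, doubling form**: the closed unit ball `B` in `ℝ³` is
equidecomposable with `B ∪ B'`, where `B'` is a translate of `B` disjoint from `B`. -/
theorem banach_tarski_doubling :
    ∃ v : EuclideanSpace ℝ (Fin 3),
      Disjoint (Metric.closedBall (0 : EuclideanSpace ℝ (Fin 3)) 1)
        ((fun x => v + x) '' Metric.closedBall (0 : EuclideanSpace ℝ (Fin 3)) 1) ∧
      Equidecomposable (Metric.closedBall (0 : EuclideanSpace ℝ (Fin 3)) 1)
        (Metric.closedBall (0 : EuclideanSpace ℝ (Fin 3)) 1 ∪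
          ((fun x => v + x) '' Metric.closedBall (0 : EuclideanSpace ℝ (Fin 3)) 1)) := by
  obtain ⟨S, f, hf, hfS⟩ := BanachTarski.exists_injective_bool_prod_closedBall
  obtain ⟨v, hv⟩ := exists_norm_eq (EuclideanSpace ℝ (Fin 3)) (show (0 : ℝ) ≤ 3 by norm_num)
  have hmem : ∀ x, x ∈ (fun x => v + x) '' Metric.closedBall (0 : EuclideanSpace ℝ (Fin 3)) 1 ↔
      x - v ∈ Metric.closedBall (0 : EuclideanSpace ℝ (Fin 3)) 1 := by
    intro x
    rw [Set.image_add_left, Set.mem_preimage, neg_add_eq_sub]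
  refine ⟨v, ?_, ?_⟩
  · refine Set.disjoint_left.2 fun x hx hx' ↦ ?_
    rw [hmem, mem_closedBall_zero_iff] at hx'
    rw [mem_closedBall_zero_iff] at hx
    have := norm_sub_le x (x - v)
    rw [sub_sub_cancel, hv] at this
    linarith
  · exact BanachTarski.equidecomposable_union S hf hfS (fun x hx ↦ (hmem x).1 hx)
      (Metric.nonempty_closedBall.2 zero_le_one)
end

section
/- Strong form of the Banach–Tarski paradox: any two bounded subsets of ℝ³ each having nonempty interior are equidecomposable. In particular, any three-dimensional body (bounded, with nonempty interior) can be split into finitely many pieces that can be moved by isometries and reassembled to yield any other such body. -/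
section FreeRotations

open Matrix

/-- Integer matrices equal to `5` times a rational rotation about the third (resp. first)
coordinate axis, or its inverse. -/
def scaledRotation : Bool × Bool → Matrix (Fin 3) (Fin 3) ℤ
  | (false, true) => !![3, -4, 0; 4, 3, 0; 0, 0, 5]
  | (false, false) => !![3, 4, 0; -4, 3, 0; 0, 0, 5]
  | (true, true) => !![5, 0, 0; 0, 3, -4; 0, 4, 3]
  | (true, false) => !![5, 0, 0; 0, 3, 4; 0, -4, 3]

theorem scaledRotation_mul_inv (i b : Bool) :
    scaledRotation (i, b) * scaledRotation (i, !b) = (25 : ℤ) • 1 := by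
  revert i b; decide

theorem transpose_scaledRotation (i b : Bool) :
    (scaledRotation (i, b))ᵀ = scaledRotation (i, !b) := by
  revert i b; decide

/-- A vector spanning the range of `scaledRotation l` modulo `5`. -/
def rangeVector : Bool × Bool → Fin 3 → ZMod 5
  | (false, true) => ![1, 3, 0]
  | (false, false) => ![3, 1, 0]
  | (true, true) => ![0, 1, 3]
  | (true, false) => ![0, 3, 1]

theorem rangeVector_ne_zero (l : Bool × Bool) : rangeVector l ≠ 0 := by
  revert l; decide

theorem scaledRotation_mulVec_rangeVector (l m : Bool × Bool) (h : l.1 = m.1 → l.2 = m.2) :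
    ∃ c : ZMod 5, c ≠ 0 ∧
      (Int.castRingHom (ZMod 5)).mapMatrix (scaledRotation l) *ᵥ rangeVector m =
        c • rangeVector l := by
  revert l m; decide

theorem prod_scaledRotation_mulVec (l : Bool × Bool) (L : List (Bool × Bool))
    (h : FreeGroup.IsReduced (l :: L)) :
    ∃ (v : Fin 3 → ZMod 5) (c : ZMod 5), c ≠ 0 ∧
      (Int.castRingHom (ZMod 5)).mapMatrix ((l :: L).map scaledRotation).prod *ᵥ v =
        c • rangeVector l := by
  induction L generalizing l with
  | nil =>
    obtain ⟨c, hc, h⟩ := scaledRotation_mulVec_rangeVector l l fun _ => rfl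
    exact ⟨_, c, hc, by simpa using h⟩
  | cons m L ih =>
    rw [FreeGroup.isReduced_cons_cons] at h
    obtain ⟨v, c, hc, hv⟩ := ih m h.2
    obtain ⟨d, hd, hlm⟩ := scaledRotation_mulVec_rangeVector l m h.1
    have : Fact (Nat.Prime 5) := ⟨by norm_num⟩
    refine ⟨v, c * d, mul_ne_zero hc hd, ?_⟩
    rw [List.map_cons, List.prod_cons, map_mul, ← mulVec_mulVec, hv, mulVec_smul, hlm, smul_smul]

theorem prod_scaledRotation_ne_smul_one {L : List (Bool × Bool)} (hL : L ≠ [])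
    (h : FreeGroup.IsReduced L) :
    (L.map scaledRotation).prod ≠ (5 : ℤ) ^ L.length • 1 := by
  obtain ⟨l, L, rfl⟩ := List.exists_cons_of_ne_nil hL
  intro heq
  obtain ⟨v, c, hc, hv⟩ := prod_scaledRotation_mulVec l L h
  have : Fact (Nat.Prime 5) := ⟨by norm_num⟩
  have h5 : ((5 : ℤ) : ZMod 5) = 0 := rfl
  have h0 : (Int.castRingHom (ZMod 5)).mapMatrix
      ((5 : ℤ) ^ (l :: L).length • (1 : Matrix (Fin 3) (Fin 3) ℤ)) = 0 := by
    rw [map_zsmul, ← Int.cast_smul_eq_zsmul (ZMod 5), Int.cast_pow, h5, List.length_cons,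
      zero_pow (Nat.succ_ne_zero _), zero_smul]
  rw [heq, h0, zero_mulVec] at hv
  exact smul_ne_zero hc (rangeVector_ne_zero l) hv.symm

/-- The rational rotation obtained by dividing `scaledRotation (i, true)` by `5`. -/
noncomputable def rationalRotation (i : Bool) : orthogonalGroup (Fin 3) ℝ :=
  ⟨(5⁻¹ : ℝ) • (Int.castRingHom ℝ).mapMatrix (scaledRotation (i, true)), by
    rw [mem_orthogonalGroup_iff, transpose_smul,
      RingHom.mapMatrix_apply, ← transpose_map, transpose_scaledRotation, smul_mul_smul_comm,
      ← RingHom.mapMatrix_apply, ← RingHom.mapMatrix_apply, ← map_mul, scaledRotation_mul_inv,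
      map_zsmul, map_one, ← Int.cast_smul_eq_zsmul ℝ, smul_smul]
    norm_num⟩

theorem five_smul_cond_rationalRotation (l : Bool × Bool) :
    (5 : ℝ) • ((cond l.2 (rationalRotation l.1) (rationalRotation l.1)⁻¹ :
      orthogonalGroup (Fin 3) ℝ) : Matrix (Fin 3) (Fin 3) ℝ) =
      (Int.castRingHom ℝ).mapMatrix (scaledRotation l) := by
  obtain ⟨i, _ | _⟩ := l
  · rw [cond_false, UnitaryGroup.inv_val, rationalRotation, star_smul, star_eq_conjTranspose,
      conjTranspose_eq_transpose_of_trivial, RingHom.mapMatrix_apply, ← transpose_map,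
      transpose_scaledRotation, smul_smul]
    norm_num
  · rw [cond_true, rationalRotation, smul_smul]
    norm_num

theorem five_pow_smul_lift_rationalRotation (L : List (Bool × Bool)) :
    (5 : ℝ) ^ L.length • (FreeGroup.lift rationalRotation (FreeGroup.mk L) :
      Matrix (Fin 3) (Fin 3) ℝ) = (Int.castRingHom ℝ).mapMatrix (L.map scaledRotation).prod := by
  rw [FreeGroup.lift_mk]
  induction L with
  | nil => simp
  | cons l L ih =>
    rw [List.map_cons, List.map_cons, List.prod_cons, List.prod_cons, map_mul, ← ih,
      ← five_smul_cond_rationalRotation, UnitaryGroup.mul_val, smul_mul_smul_comm,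
      List.length_cons, pow_succ']

theorem lift_rationalRotation_injective :
    Function.Injective (FreeGroup.lift rationalRotation) := by
  rw [injective_iff_map_eq_one]
  intro g hg
  by_contra hne
  refine prod_scaledRotation_ne_smul_one (mt FreeGroup.toWord_eq_nil_iff.1 hne)
    FreeGroup.isReduced_toWord ?_
  have h := five_pow_smul_lift_rationalRotation g.toWord
  rw [FreeGroup.mk_toWord, hg, UnitaryGroup.one_val] at h
  apply Matrix.map_injective (f := Int.castRingHom ℝ) Int.cast_injective
  change (Int.castRingHom ℝ).mapMatrix _ = (Int.castRingHom ℝ).mapMatrix _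
  rw [← h, map_zsmul, map_one,
    ← Int.cast_smul_eq_zsmul ℝ]
  simp

/-- The group of isometries of Euclidean space contains a free group of rank two. -/
theorem exists_injective_freeGroup_hom_linearIsometryEquiv :
    ∃ ρ : FreeGroup Bool →* (EuclideanSpace ℝ (Fin 3) ≃ₗᵢ[ℝ] EuclideanSpace ℝ (Fin 3)),
      Function.Injective ρ := by
  let e : Matrix (Fin 3) (Fin 3) ℝ ≃⋆*
      (EuclideanSpace ℝ (Fin 3) →L[ℝ] EuclideanSpace ℝ (Fin 3)) :=
    { toEuclideanCLM (n := Fin 3) (𝕜 := ℝ) with }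
  let φ : orthogonalGroup (Fin 3) ℝ →*
      (EuclideanSpace ℝ (Fin 3) ≃ₗᵢ[ℝ] EuclideanSpace ℝ (Fin 3)) :=
    Unitary.linearIsometryEquiv.toMonoidHom.comp (Unitary.mapEquiv e).toMulEquiv.toMonoidHom
  exact ⟨φ.comp (FreeGroup.lift rationalRotation),
    (Unitary.linearIsometryEquiv.injective.comp (Unitary.mapEquiv e).injective).comp
      lift_rationalRotation_injective⟩

end FreeRotations

open Set Function

/-- A free group contains disjoint piecewise translates of itself indexed by the generators:
`φ i` maps the group into the words beginning with `i` or `i⁻¹`, either fixing an element or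
multiplying it by the generator `i`. -/
theorem FreeGroup.exists_paradoxical_maps {α : Type*} [DecidableEq α] :
    ∃ φ : α → FreeGroup α → FreeGroup α,
      (∀ i j g h, φ i g = φ j h → i = j ∧ g = h) ∧
      ∀ i g, φ i g = g ∨ φ i g = of i * g := by
  classical
  let φ : α → FreeGroup α → FreeGroup α := fun i g =>
    if g ∈ startsWith (i, false) then g else of i * g
  have hpos (i : α) (g : FreeGroup α) (hg : g ∉ startsWith (i, false)) :
      of i * g ∈ startsWith (i, true) :=
    startsWith_mk_mul (w := (i, true)) g hg
  have hmem (i g) : ∃ b, φ i g ∈ startsWith (i, b) := by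
    by_cases hg : g ∈ startsWith (i, false)
    · exact ⟨false, by simp [φ, hg]⟩
    · exact ⟨true, by simpa only [φ, hg, if_false] using hpos i g hg⟩
  have hdisj (w w' : α × Bool) (g) (h : g ∈ startsWith w) (h' : g ∈ startsWith w') : w = w' := by
    by_contra hne
    exact Set.disjoint_left.1 (startsWith.disjoint_iff_ne.2 hne) h h'
  refine ⟨φ, fun i j g h heq => ?_, fun i g => ?_⟩
  · obtain ⟨b, hb⟩ := hmem i g
    obtain ⟨c, hc⟩ := hmem j h
    have hij : i = j := congrArg Prod.fst (hdisj _ _ _ hb (heq ▸ hc))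
    subst hij
    refine ⟨rfl, ?_⟩
    by_cases hg : g ∈ startsWith (i, false) <;> by_cases hh : h ∈ startsWith (i, false)
    · simpa [φ, hg, hh] using heq
    · simp only [φ, hg, hh, if_true, if_false] at heq
      exact absurd (hdisj _ _ _ hg (heq ▸ hpos i h hh)) (by simp)
    · simp only [φ, hg, hh, if_true, if_false] at heq
      exact absurd (hdisj _ _ _ hh (heq ▸ hpos i g hg)) (by simp)
    · simpa [φ, hg, hh] using heq
  · by_cases hg : g ∈ startsWith (i, false) <;> simp [φ, hg]

/-- If a free group acts freely at the points of `P`, then `P` has disjoint piecewise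
translates indexed by the generators. -/
theorem FreeGroup.exists_paradoxical_maps_of_free {α X : Type*} [DecidableEq α]
    [MulAction (FreeGroup α) X] {P : Set X}
    (hfree : ∀ x ∈ P, ∀ g : FreeGroup α, g • x = x → g = 1) :
    ∃ f : α → X → X,
      (∀ i j, ∀ x ∈ P, ∀ y ∈ P, f i x = f j y → i = j ∧ x = y) ∧
      ∀ i x, f i x = x ∨ f i x = of i • x := by
  obtain ⟨φ, hφ, hφ'⟩ := exists_paradoxical_maps (α := α)
  let r (x : X) : X := (Quotient.mk (MulAction.orbitRel (FreeGroup α) X) x).out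
  have hr (x : X) : ∃ g : FreeGroup α, g • r x = x := by
    have h := Quotient.exact (s := MulAction.orbitRel (FreeGroup α) X)
      (Quotient.out_eq (Quotient.mk (MulAction.orbitRel (FreeGroup α) X) x))
    exact (MulAction.orbitRel (FreeGroup α) X).symm h
  have hr' (g : FreeGroup α) (x : X) : r (g • x) = r x :=
    congrArg Quotient.out (Quotient.sound (s := MulAction.orbitRel (FreeGroup α) X)
      (MulAction.mem_orbit x g))
  choose γ hγ using hr
  have hrφ (i x) : r (φ i (γ x) • r x) = r x := by
    rw [hr', ← hr' (γ x) (r x), hγ]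
  refine ⟨fun i x => φ i (γ x) • r x, fun i j x hx y hy h => ?_, fun i x => ?_⟩
  · have hxy : r x = r y := by simpa only [hrφ] using congrArg r h
    have hinj (g g' : FreeGroup α) (h : g • r x = g' • r x) : g = g' := by
      have h1 := hfree x hx (γ x * (g'⁻¹ * g) * (γ x)⁻¹) (by
        have h2 : (γ x)⁻¹ • x = r x := by rw [inv_smul_eq_iff, hγ]
        rw [mul_smul, h2, mul_smul, mul_smul, h, inv_smul_smul, hγ])
      rw [conj_eq_one_iff, inv_mul_eq_one] at h1
      exact h1.symm
    simp only [← hxy] at h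
    obtain ⟨hij, hg⟩ := hφ _ _ _ _ (hinj _ _ h)
    exact ⟨hij, by rw [← hγ x, ← hγ y, hg, hxy]⟩
  · obtain h | h := hφ' i (γ x) <;> simp only [h, mul_smul, hγ, true_or, or_true]

/-- Generically translated copies of a countable union of proper subspaces have no common
point, as soon as there are more copies than the dimension. -/
theorem exists_translates_iInter_eq_empty {V ι : Type*} [NormedAddCommGroup V] [NormedSpace ℝ V]
    [FiniteDimensional ℝ V] [Countable ι] (H : ι → Submodule ℝ V) (hH : ∀ j, H j ≠ ⊤)
    {ε : ℝ} (hε : 0 < ε) :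
    ∃ v : Fin (Module.finrank ℝ V + 1) → V,
      (∀ i, ‖v i‖ < ε) ∧ ∀ x, ∃ i, ∀ j, x - v i ∉ H j := by
  set n := Module.finrank ℝ V with hn
  borelize (Fin (n + 1) → V)
  let T (s : Fin (n + 1) → ι) : (V × ∀ i, H (s i)) →ₗ[ℝ] (Fin (n + 1) → V) :=
    LinearMap.pi fun i => LinearMap.fst ℝ _ _ -
      (H (s i)).subtype ∘ₗ LinearMap.proj i ∘ₗ LinearMap.snd ℝ _ _
  have hT (s) : LinearMap.range (T s) ≠ ⊤ := by
    intro htop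
    have h1 := LinearMap.finrank_range_le (T s)
    have h2 : ∑ i, (Module.finrank ℝ (H (s i)) + 1) ≤ ∑ _i : Fin (n + 1), n :=
      Finset.sum_le_sum fun i _ => Submodule.finrank_lt (hH (s i))
    rw [htop, finrank_top, Module.finrank_prod, Module.finrank_pi_fintype,
      Module.finrank_pi_fintype, ← hn] at h1
    rw [Finset.sum_add_distrib] at h2
    simp only [Finset.sum_const, Finset.card_univ, Fintype.card_fin, smul_eq_mul] at h1 h2
    omega
  let μ : MeasureTheory.Measure (Fin (n + 1) → V) := MeasureTheory.Measure.addHaar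
  have hnull : μ (⋃ s, (LinearMap.range (T s) : Set (Fin (n + 1) → V))) = 0 :=
    MeasureTheory.measure_iUnion_null fun s => MeasureTheory.Measure.addHaar_submodule μ _ (hT s)
  obtain ⟨v, hv, hvT⟩ : ∃ v ∈ Metric.ball (0 : Fin (n + 1) → V) ε,
      v ∉ ⋃ s, (LinearMap.range (T s) : Set (Fin (n + 1) → V)) := by
    by_contra! hsub
    exact (Metric.measure_ball_pos μ 0 hε).ne' (MeasureTheory.measure_mono_null hsub hnull)
  refine ⟨v, fun i => (norm_le_pi_norm v i).trans_lt (mem_ball_zero_iff.1 hv), fun x => ?_⟩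
  by_contra! hx
  choose s hs using hx
  refine hvT (mem_iUnion.2 ⟨s, ⟨(x, fun i => ⟨x - v i, hs i⟩), ?_⟩⟩)
  ext i
  simp [T]

section PiecewiseEmbeds

open scoped Pointwise

variable {E : Type*} [PseudoEMetricSpace E] {A B C : Set E}

/-- `A` can be cut into finitely many pieces which can be moved by isometries to pairwise
disjoint subsets of `B`. -/
def PiecewiseEmbeds (A B : Set E) : Prop :=
  ∃ f : E → E, InjOn f A ∧ MapsTo f A B ∧
    ∃ S : Set (E ≃ᵢ E), S.Finite ∧ ∀ x ∈ A, ∃ g ∈ S, f x = g x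

theorem piecewiseEmbeds_of_image_subset (g : E ≃ᵢ E) (h : g '' A ⊆ B) : PiecewiseEmbeds A B :=
  ⟨g, g.injective.injOn, mapsTo_iff_image_subset.2 h, {g}, finite_singleton g, by simp⟩

theorem PiecewiseEmbeds.of_subset (h : A ⊆ B) : PiecewiseEmbeds A B :=
  piecewiseEmbeds_of_image_subset 1 (by simpa using h)

theorem PiecewiseEmbeds.trans (hAB : PiecewiseEmbeds A B) (hBC : PiecewiseEmbeds B C) :
    PiecewiseEmbeds A C := by
  obtain ⟨f, hfi, hfm, S, hS, hfS⟩ := hAB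
  obtain ⟨g, hgi, hgm, T, hT, hgT⟩ := hBC
  refine ⟨g ∘ f, hgi.comp hfi hfm, hgm.comp hfm, T * S, hT.mul hS, fun x hx => ?_⟩
  obtain ⟨s, hs, hfs⟩ := hfS x hx
  obtain ⟨t, ht, hgt⟩ := hgT _ (hfm hx)
  exact ⟨t * s, mul_mem_mul ht hs, by rw [comp_apply, hgt, hfs, IsometryEquiv.mul_apply]⟩

/-- A Banach–Schröder–Bernstein theorem for finite decompositions. -/
theorem PiecewiseEmbeds.antisymm (hAB : PiecewiseEmbeds A B) (hBA : PiecewiseEmbeds B A) :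
    ∃ h : E → E, BijOn h A B ∧
      ∃ S : Set (E ≃ᵢ E), S.Finite ∧ ∀ x ∈ A, ∃ g ∈ S, h x = g x := by
  classical
  obtain ⟨f, hfi, hfm, S, hS, hfS⟩ := hAB
  obtain ⟨k, hki, hkm, T, hT, hkT⟩ := hBA
  obtain ⟨h, hbij, hR⟩ := Embedding.schroeder_bernstein_of_rel
    (hfm.restrict_inj.2 hfi) (hkm.restrict_inj.2 hki)
    (fun a b => ∃ g ∈ S ∪ T⁻¹, (b : E) = g (a : E))
    (fun a => (hfS a a.2).imp fun g hg => ⟨.inl hg.1, hg.2⟩)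
    (fun b => by
      obtain ⟨t, ht, hkt⟩ := hkT b b.2
      refine ⟨t⁻¹, .inr (inv_mem_inv.2 ht), ?_⟩
      rw [MapsTo.val_restrict_apply, hkt]
      exact (t.symm_apply_apply _).symm)
  let h' : E → E := fun x => if hx : x ∈ A then h ⟨x, hx⟩ else x
  have hh' (x : E) (hx : x ∈ A) : h' x = h ⟨x, hx⟩ := dif_pos hx
  refine ⟨h', ⟨fun x hx => ?_, fun x hx y hy hxy => ?_, fun y hy => ?_⟩,
    S ∪ T⁻¹, hS.union hT.inv, fun x hx => ?_⟩
  · rw [hh' x hx]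
    exact (h ⟨x, hx⟩).2
  · rw [hh' x hx, hh' y hy] at hxy
    exact congrArg Subtype.val (hbij.1 (Subtype.ext hxy))
  · obtain ⟨x, hx⟩ := hbij.2 ⟨y, hy⟩
    exact ⟨x, x.2, by rw [hh' x x.2, hx]⟩
  · rw [hh' x hx]
    exact hR ⟨x, hx⟩

/-- A set containing two disjoint piecewise translates of itself. -/
def IsParadoxical (P : Set E) : Prop :=
  ∃ A B : Set E, Disjoint A B ∧ A ∪ B ⊆ P ∧ PiecewiseEmbeds P A ∧ PiecewiseEmbeds P B

theorem PiecewiseEmbeds.union {A' B' : Set E} (hd : Disjoint A' B') (hA : PiecewiseEmbeds A A')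
    (hB : PiecewiseEmbeds B B') : PiecewiseEmbeds (A ∪ B) (A' ∪ B') := by
  classical
  obtain ⟨f, hfi, hfm, S, hS, hfS⟩ := hA
  obtain ⟨k, hki, hkm, T, hT, hkT⟩ := hB
  have hf (x) (hx : x ∈ A) : A.piecewise f k x = f x := piecewise_eq_of_mem _ _ _ hx
  have hk (x) (hx : x ∉ A) : A.piecewise f k x = k x := piecewise_eq_of_notMem _ _ _ hx
  rw [← union_sdiff_self]
  have hk' : EqOn (A.piecewise f k) k (B \ A) := fun x hx => hk x hx.2
  refine ⟨A.piecewise f k, ?_, ?_, S ∪ T, hS.union hT, ?_⟩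
  · rw [injOn_union disjoint_sdiff_self_right]
    refine ⟨hfi.congr fun x hx => (hf x hx).symm, (hki.mono sdiff_subset).congr hk'.symm, ?_⟩
    intro x hx y hy
    rw [hf x hx, hk y hy.2]
    exact hd.ne_of_mem (hfm hx) (hkm hy.1)
  · exact (hfm.mono_right subset_union_left).congr (fun x hx => (hf x hx).symm) |>.union
      (((hkm.mono_left sdiff_subset).mono_right subset_union_right).congr hk'.symm)
  · rintro x (hx | hx)
    · obtain ⟨g, hg, h⟩ := hfS x hx
      exact ⟨g, .inl hg, (hf x hx).trans h⟩
    · obtain ⟨g, hg, h⟩ := hkT x hx.1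
      exact ⟨g, .inr hg, (hk x hx.2).trans h⟩

theorem IsParadoxical.piecewiseEmbeds_union {P : Set E} (hP : IsParadoxical P)
    (hA : PiecewiseEmbeds A P) (hB : PiecewiseEmbeds B P) : PiecewiseEmbeds (A ∪ B) P := by
  obtain ⟨A', B', hd, hsub, hA', hB'⟩ := hP
  exact ((hA.trans hA').union hd (hB.trans hB')).trans (.of_subset hsub)

theorem IsParadoxical.piecewiseEmbeds_iUnion {ι : Type*} [Finite ι] {P : Set E}
    (hP : IsParadoxical P) {A : ι → Set E} (hA : ∀ i, PiecewiseEmbeds (A i) P) :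
    PiecewiseEmbeds (⋃ i, A i) P := by
  have h (s : Set ι) : PiecewiseEmbeds (⋃ i ∈ s, A i) P := by
    induction s, s.toFinite using Set.Finite.induction_on with
    | empty => exact .of_subset (by simp)
    | insert _ _ ih =>
      rw [biUnion_insert]
      exact hP.piecewiseEmbeds_union (hA _) ih
  simpa using h univ

end PiecewiseEmbeds

theorem equidecomposable_of_piecewiseEmbeds {X Y : Set (EuclideanSpace ℝ (Fin 3))}
    (hXY : PiecewiseEmbeds X Y) (hYX : PiecewiseEmbeds Y X) : Equidecomposable X Y := by
  obtain ⟨h, hbij, S, hS, hhS⟩ := hXY.antisymm hYX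
  obtain ⟨n, g, hg⟩ := (hS.insert 1).fin_param
  have hn : 0 < n := by
    obtain ⟨i, -⟩ : (1 : EuclideanSpace ℝ (Fin 3) ≃ᵢ _) ∈ range g := hg.2 ▸ mem_insert _ _
    exact i.pos
  have hk (x) : ∃ i, x ∈ X → h x = g i x := by
    by_cases hx : x ∈ X
    · obtain ⟨t, ht, hxt⟩ := hhS x hx
      obtain ⟨i, rfl⟩ : t ∈ range g := hg.2 ▸ mem_insert_of_mem _ ht
      exact ⟨i, fun _ => hxt⟩
    · exact ⟨⟨0, hn⟩, fun h => absurd h hx⟩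
  choose k hk using hk
  have himage (i) : g i '' {x ∈ X | k x = i} = h '' {x ∈ X | k x = i} :=
    image_congr fun x hx => by rw [hk x hx.1, hx.2]
  have hdisj (i j : Fin n) (hij : i ≠ j) :
      Disjoint {x ∈ X | k x = i} {x ∈ X | k x = j} :=
    disjoint_left.2 fun x hx hx' => hij (hx.2.symm.trans hx'.2)
  have hunion : X = ⋃ i, {x ∈ X | k x = i} := by
    ext x
    simp
  refine ⟨n, hn, fun i => {x ∈ X | k x = i}, g, hdisj, hunion, fun i j hij => ?_, ?_⟩
  · rw [himage, himage]
    exact (hdisj i j hij).image hbij.injOn (sep_subset _ _) (sep_subset _ _)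
  · simp only [himage]
    rw [← image_iUnion, ← hunion, hbij.image_eq]

/-- The set of points with trivial stabilizer, intersected with a ball, is paradoxical. -/
theorem isParadoxical_ball_inter {V : Type*} [NormedAddCommGroup V] [NormedSpace ℝ V]
    (ρ : FreeGroup Bool →* (V ≃ₗᵢ[ℝ] V)) (r : ℝ) :
    IsParadoxical (Metric.ball (0 : V) r ∩ {x | ∀ g, ρ g x = x → g = 1}) := by
  let _ : MulAction (FreeGroup Bool) V :=
    { smul g x := ρ g x
      one_smul x := by change ρ 1 x = x; rw [map_one]; rfl
      mul_smul g h x := by change ρ (g * h) x = ρ g (ρ h x); rw [map_mul]; rfl }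
  have hsmul (g : FreeGroup Bool) (x : V) : g • x = ρ g x := rfl
  set P := Metric.ball (0 : V) r ∩ {x | ∀ g, ρ g x = x → g = 1}
  obtain ⟨f, hf, hf'⟩ := FreeGroup.exists_paradoxical_maps_of_free (P := P)
    fun x hx g hg => hx.2 g hg
  have hP (h : FreeGroup Bool) (x : V) (hx : x ∈ P) : h • x ∈ P := by
    refine ⟨by simpa [hsmul] using hx.1, fun g hg => ?_⟩
    have h1 := hx.2 (h⁻¹ * g * h) (by
      rw [← hsmul, mul_smul, mul_smul, inv_smul_eq_iff]
      exact hg)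
    simpa using conj_eq_one_iff.1 (show h⁻¹ * g * h⁻¹⁻¹ = 1 by rwa [inv_inv])
  have hemb (i : Bool) : PiecewiseEmbeds P (f i '' P) := by
    refine ⟨f i, fun x hx y hy h => (hf i i x hx y hy h).2, mapsTo_image _ _,
      {1, (ρ (FreeGroup.of i)).toIsometryEquiv}, toFinite _, fun x _ => ?_⟩
    obtain h | h := hf' i x
    · exact ⟨1, .inl rfl, h⟩
    · exact ⟨_, .inr rfl, h⟩
  have hsub (i : Bool) : f i '' P ⊆ P := by
    rintro _ ⟨x, hx, rfl⟩
    obtain h | h := hf' i x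
    · rwa [h]
    · exact h ▸ hP _ x hx
  refine ⟨f false '' P, f true '' P, ?_, union_subset (hsub _) (hsub _), hemb _, hemb _⟩
  rw [disjoint_left]
  rintro _ ⟨x, hx, rfl⟩ ⟨y, hy, h⟩
  exact Bool.noConfusion (hf _ _ y hy x hx h).1

theorem piecewiseEmbeds_of_isBounded_of_interior_nonempty
    {X Y : Set (EuclideanSpace ℝ (Fin 3))} (hX : Bornology.IsBounded X)
    (hY : (interior Y).Nonempty) : PiecewiseEmbeds X Y := by
  obtain ⟨ρ, hρ⟩ := exists_injective_freeGroup_hom_linearIsometryEquiv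
  obtain ⟨c, hc⟩ := hY
  obtain ⟨r, hr, hball⟩ := Metric.isOpen_iff.1 isOpen_interior c hc
  have hP := isParadoxical_ball_inter ρ r
  set P := Metric.ball (0 : EuclideanSpace ℝ (Fin 3)) r ∩ {x | ∀ g, ρ g x = x → g = 1}
  have hPY : PiecewiseEmbeds P Y := by
    refine piecewiseEmbeds_of_image_subset (IsometryEquiv.addRight c) ?_
    rintro _ ⟨x, hx, rfl⟩
    exact interior_subset (hball (by simpa using hx.1))
  have hker (g : {g : FreeGroup Bool // g ≠ 1}) :
      LinearMap.eqLocus (ρ g : _ →ₗ[ℝ] EuclideanSpace ℝ (Fin 3)) LinearMap.id ≠ ⊤ := by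
    intro htop
    refine g.2 (hρ ?_)
    rw [map_one]
    ext1 x
    exact htop.ge (Submodule.mem_top (x := x))
  have : Countable (FreeGroup Bool) := FreeGroup.toWord_injective.countable
  obtain ⟨v, hv, hcover⟩ := exists_translates_iInter_eq_empty _ hker (half_pos hr)
  refine .trans (.of_subset subset_closure) (.trans ?_ hPY)
  refine hX.isCompact_closure.induction_on (p := fun s => PiecewiseEmbeds s P)
    (.of_subset (empty_subset _)) (fun s t hst ht => .trans (.of_subset hst) ht)
    (fun s t hs ht => hP.piecewiseEmbeds_union hs ht) fun x _ =>
      ⟨Metric.ball x (r / 2), mem_nhdsWithin_of_mem_nhds (Metric.ball_mem_nhds x (half_pos hr)), ?_⟩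
  refine .trans (.of_subset (B := ⋃ i, IsometryEquiv.addRight (-(x + v i)) ⁻¹' P) fun y hy => ?_)
    (hP.piecewiseEmbeds_iUnion fun i =>
      piecewiseEmbeds_of_image_subset (IsometryEquiv.addRight (-(x + v i)))
        (image_preimage_subset _ _))
  obtain ⟨i, hi⟩ := hcover (y - x)
  have hyv : y + -(x + v i) = y - x - v i := by abel
  refine mem_iUnion.2 ⟨i, ?_⟩
  rw [mem_preimage, IsometryEquiv.addRight_apply, hyv]
  refine ⟨?_, fun g hg => ?_⟩
  · rw [mem_ball_zero_iff]
    have h1 : ‖y - x‖ < r / 2 := mem_ball_iff_norm.1 hy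
    linarith [norm_sub_le (y - x) (v i), hv i]
  · by_contra hne
    exact hi ⟨g, hne⟩ hg

/-- **Strong Banach–Tarski paradox**: any two bounded subsets of `ℝ³` with nonempty
interior are equidecomposable. -/
theorem banach_tarski_strong (X Y : Set (EuclideanSpace ℝ (Fin 3)))
    (hXb : Bornology.IsBounded X) (hYb : Bornology.IsBounded Y)
    (hXi : (interior X).Nonempty) (hYi : (interior Y).Nonempty) :
    Equidecomposable X Y := by
  exact equidecomposable_of_piecewiseEmbeds
    (piecewiseEmbeds_of_isBounded_of_interior_nonempty hXb hYi)
    (piecewiseEmbeds_of_isBounded_of_interior_nonempty hYb hXi)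
end
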